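/- Let g : ℝ → ℝ be such that x ↦ √(g(x²)) is smooth on ℝ (as a function of x ∈ ℝ, in particular at 0). Then the surface of revolution (x, t) ↦ (x cos k₁t, x sin k₁t, √(2 g(x²/2)), 0) ∈ ℝ⁴ with k₁ ≠ 0 is smooth at x = 0: it is the image of the smooth map ζ ↦ (ζ, G(|ζ|²), 0) where G is a smooth function with G(x²) = √(2g(x²/2)). -/

import Mathlib

open Complex

lemma aux_contDiff_of_seq (S : ℕ → ℝ → ℝ) (h : ∀ n x, HasDerivAt (S n) (S (n+1) x) x) :
    ContDiff ℝ (⊤ : ℕ∞) (S 0) := by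
  have key : ∀ m : ℕ, ∀ n, ContDiff ℝ (m : WithTop ℕ∞) (S n) := by
    intro m
    induction m with
    | zero =>
      intro n
      exact contDiff_zero.2 (continuous_iff_continuousAt.2 fun x => (h n x).continuousAt)
    | succ m ih =>
      intro n
      have hd : deriv (S n) = S (n+1) := funext fun x => (h n x).deriv
      push_cast
      rw [contDiff_succ_iff_deriv, hd]
      exact ⟨fun x => (h n x).differentiableAt, by simp, ih _⟩
  exact contDiff_infty.2 fun m => key m 0

lemma aux_hasDerivAt_iteratedDeriv {u : ℝ → ℝ} (hu : ContDiff ℝ (⊤ : ℕ∞) u) (n : ℕ) (x : ℝ) :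
    HasDerivAt (iteratedDeriv n u) (iteratedDeriv (n+1) u x) x := by
  rw [iteratedDeriv_succ]
  exact ((hu.differentiable_iteratedDeriv n (by exact_mod_cast ENat.natCast_lt_top n)) x).hasDerivAt

lemma aux_integral_smooth {u : ℝ → ℝ} (hu : ContDiff ℝ (⊤ : ℕ∞) u) :
    ContDiff ℝ (⊤ : ℕ∞) (fun x => ∫ t in (0:ℝ)..1, u (t * x)) := by
  have hc : ∀ n, Continuous (iteratedDeriv n u) := fun n =>
    continuous_iff_continuousAt.2 fun x => (aux_hasDerivAt_iteratedDeriv hu n x).continuousAt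
  have := aux_contDiff_of_seq
    (fun n x => ∫ t in (0:ℝ)..1, t ^ n * iteratedDeriv n u (t * x)) ?_
  · simpa using this
  intro n x
  have hcj : Continuous (fun p : ℝ × ℝ => p.2 ^ (n+1) * iteratedDeriv (n+1) u (p.2 * p.1)) := by
    have := hc (n+1)
    fun_prop
  obtain ⟨C, hC⟩ := ((isCompact_closedBall x 1).prod (isCompact_Icc (a := (0:ℝ)) (b := 1))).exists_bound_of_continuousOn
    hcj.continuousOn
  refine (intervalIntegral.hasDerivAt_integral_of_dominated_loc_of_deriv_le
    (F := fun x t => t ^ n * iteratedDeriv n u (t * x))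
    (F' := fun x t => t ^ (n+1) * iteratedDeriv (n+1) u (t * x))
    (bound := fun _ => C) (Metric.ball_mem_nhds x one_pos) ?_ ?_ ?_ ?_ ?_ ?_).2
  · refine Filter.Eventually.of_forall fun y => ?_
    have := hc n
    exact (by fun_prop : Continuous fun t => t ^ n * iteratedDeriv n u (t * y)).aestronglyMeasurable
  · have := hc n
    exact (by fun_prop : Continuous fun t => t ^ n * iteratedDeriv n u (t * x)).intervalIntegrable _ _
  · have := hc (n+1)
    exact (by fun_prop : Continuous fun t => t ^ (n+1) * iteratedDeriv (n+1) u (t * x)).aestronglyMeasurable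
  · refine Filter.Eventually.of_forall fun t ht y hy => ?_
    rw [Set.uIoc_of_le zero_le_one] at ht
    exact hC (y, t) ⟨Metric.ball_subset_closedBall hy, ht.1.le, ht.2⟩
  · exact intervalIntegrable_const
  · refine Filter.Eventually.of_forall fun t ht y hy => ?_
    have h1 := (aux_hasDerivAt_iteratedDeriv hu n (t * y)).comp y ((hasDerivAt_id y).const_mul t)
    refine (h1.const_mul (t ^ n)).congr_deriv ?_
    ring

/-- Even smooth `f`: `f'(x) = 2 x q(x)` with `q` even and smooth. -/
lemma aux_div {f : ℝ → ℝ} (hf : ContDiff ℝ (⊤ : ℕ∞) f) (he : ∀ x, f (-x) = f x) :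
    ∃ q : ℝ → ℝ, ContDiff ℝ (⊤ : ℕ∞) q ∧ (∀ x, q (-x) = q x) ∧ ∀ x, deriv f x = 2 * x * q x := by
  have hf' : ContDiff ℝ (⊤ : ℕ∞) (deriv f) := (contDiff_infty_iff_deriv.1 hf).2
  have hf'' : ContDiff ℝ (⊤ : ℕ∞) (deriv (deriv f)) := (contDiff_infty_iff_deriv.1 hf').2
  have hodd : ∀ x, deriv f (-x) = - deriv f x := by
    intro x
    have : deriv (fun y => f (-y)) x = deriv f x := by simp only [he]
    rw [deriv_comp_neg] at this
    linarith
  have heven : ∀ x, deriv (deriv f) (-x) = deriv (deriv f) x := by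
    intro x
    have : deriv (fun y => deriv f (-y)) x = - deriv (deriv f) x := by
      simp only [hodd]; simp
    rw [deriv_comp_neg] at this
    linarith
  refine ⟨fun x => (1/2) * ∫ t in (0:ℝ)..1, deriv (deriv f) (t * x), ?_, ?_, ?_⟩
  · exact contDiff_const.mul (aux_integral_smooth hf'')
  · intro x
    simp only [mul_neg, heven]
  · intro x
    have h0 : deriv f 0 = 0 := by
      have := hodd 0
      simp at this; linarith
    have := intervalIntegral.integral_eq_sub_of_hasDerivAt (a := 0) (b := 1)
      (f := fun t => deriv f (t * x)) (f' := fun t => x * deriv (deriv f) (t * x)) ?_ ?_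
    · rw [intervalIntegral.integral_const_mul] at this
      simp only [one_mul, zero_mul, h0, sub_zero] at this
      rw [← this]; ring
    · intro t _
      have h1 := ((hf'.differentiable (by simp)) (t * x)).hasDerivAt.comp t
        ((hasDerivAt_id t).mul_const x)
      refine h1.congr_deriv ?_
      ring
    · have := hf''.continuous
      exact (by fun_prop : Continuous fun t => x * deriv (deriv f) (t * x)).intervalIntegrable _ _

lemma aux_sqrt_hasDeriv {f q : ℝ → ℝ} (hf : ContDiff ℝ (⊤ : ℕ∞) f) (hq : Continuous q)
    (h : ∀ x, deriv f x = 2 * x * q x) (y : ℝ) (hy : 0 ≤ y) :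
    HasDerivWithinAt (fun y => f (√y)) (q (√y)) (Set.Ici y) y ∧
    (0 < y → HasDerivAt (fun y => f (√y)) (q (√y)) y) := by
  have hpos : ∀ y : ℝ, 0 < y → HasDerivAt (fun y => f (√y)) (q (√y)) y := by
    intro y hy
    have h1 := ((hf.differentiable (by simp)) (√y)).hasDerivAt.comp y (Real.hasDerivAt_sqrt hy.ne')
    refine h1.congr_deriv ?_
    rw [h]
    have := Real.sqrt_pos.2 hy
    field_simp
  refine ⟨?_, hpos y⟩
  rcases hy.lt_or_eq with hy | rfl
  · exact (hpos y hy).hasDerivWithinAt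
  have hfc := hf.continuous
  refine hasDerivWithinAt_Ici_of_tendsto_deriv (s := Set.Ioi 0)
    (fun z hz => (hpos z hz).differentiableAt.differentiableWithinAt)
    (by fun_prop : Continuous fun y => f (√y)).continuousWithinAt self_mem_nhdsWithin ?_
  have : Filter.Tendsto (fun y => q (√y)) (nhdsWithin 0 (Set.Ioi 0)) (nhds (q (√0))) :=
    (by fun_prop : Continuous fun y => q (√y)).continuousWithinAt
  refine this.congr' ?_
  filter_upwards [self_mem_nhdsWithin] with z hz
  exact (hpos z hz).deriv.symm

/-- Borel's lemma. -/
lemma aux_borel (a : ℕ → ℝ) :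
    ∃ b : ℝ → ℝ, ContDiff ℝ (⊤ : ℕ∞) b ∧ ∀ n, iteratedDeriv n b 0 = a n := by
  let χ : ContDiffBump (0:ℝ) := ⟨1, 2, one_pos, one_lt_two⟩
  let ψ : ℕ → ℝ → ℝ := fun n x => x ^ n * χ x
  have hψ : ∀ n, ContDiff ℝ (⊤ : ℕ∞) (ψ n) := fun n => (contDiff_id.pow n).mul χ.contDiff
  have hψs : ∀ n, HasCompactSupport (ψ n) := fun n => χ.hasCompactSupport.mul_left
  have hbd : ∀ k n, ∃ C : ℝ, ∀ x, ‖iteratedDeriv k (ψ n) x‖ ≤ C := by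
    intro k n
    have h1 := (hψs n).iteratedFDeriv (𝕜 := ℝ) k
    obtain ⟨C, hC⟩ := h1.exists_bound_of_continuous
      ((hψ n).continuous_iteratedFDeriv (by exact_mod_cast le_top))
    refine ⟨C, fun x => ?_⟩
    rw [← norm_iteratedFDeriv_eq_norm_iteratedDeriv]
    exact hC x
  choose C hC using hbd
  have hC0 : ∀ k n, 0 ≤ C k n := fun k n => (norm_nonneg _).trans (hC k n 0)
  let c : ℕ → ℝ := fun n => a n / n.factorial
  let L : ℕ → ℝ := fun n => 1 + 2 ^ n * (|c n| * ∑ k ∈ Finset.range n, C k n)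
  have hS0 : ∀ n, 0 ≤ ∑ k ∈ Finset.range n, C k n := fun n =>
    Finset.sum_nonneg fun k _ => hC0 k n
  have hL1 : ∀ n, 1 ≤ L n := fun n => by
    have := hS0 n
    have : 0 ≤ 2 ^ n * (|c n| * ∑ k ∈ Finset.range n, C k n) := by positivity
    simp only [L]; linarith
  let u : ℕ → ℝ → ℝ := fun n x => (c n / L n ^ n) * ψ n (L n * x)
  have hu : ∀ n, ContDiff ℝ (⊤ : ℕ∞) (u n) := fun n =>
    contDiff_const.mul ((hψ n).comp (contDiff_const.mul contDiff_id))
  have hud : ∀ k n x, iteratedDeriv k (u n) x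
      = (c n / L n ^ n) * (L n ^ k * iteratedDeriv k (ψ n) (L n * x)) := by
    intro k n x
    simp only [u]
    rw [iteratedDeriv_const_mul_field, iteratedDeriv_comp_const_mul]
    exact (hψ n).of_le (by exact_mod_cast le_top)
  let v : ℕ → ℕ → ℝ := fun k n =>
    if k < n then (1/2) ^ n else |c n / L n ^ n| * (L n ^ k * C k n)
  have hv : ∀ k, Summable (v k) := by
    intro k
    rw [← summable_nat_add_iff (k+1)]
    have : Summable fun n : ℕ => (1/2 : ℝ) ^ (n + (k+1)) :=
      (summable_nat_add_iff (k+1)).2 summable_geometric_two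
    refine this.congr fun n => ?_
    simp only [v]
    rw [if_pos (by omega)]
  have huv : ∀ k n x, ‖iteratedFDeriv ℝ k (u n) x‖ ≤ v k n := by
    intro k n x
    have hLp : 0 < L n := lt_of_lt_of_le one_pos (hL1 n)
    have hgen : ‖iteratedFDeriv ℝ k (u n) x‖ ≤ |c n / L n ^ n| * (L n ^ k * C k n) := by
      rw [norm_iteratedFDeriv_eq_norm_iteratedDeriv, hud, norm_mul, norm_mul,
        Real.norm_eq_abs, Real.norm_of_nonneg (pow_pos hLp k).le]
      gcongr
      exact hC _ _ _
    simp only [v]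
    split_ifs with hk
    · refine hgen.trans ?_
      have h1 : C k n ≤ ∑ k ∈ Finset.range n, C k n :=
        Finset.single_le_sum (f := fun k => C k n) (fun i _ => hC0 i n) (Finset.mem_range.2 hk)
      have h2 : L n * L n ^ k ≤ L n ^ n := by
        rw [← pow_succ']
        exact pow_le_pow_right₀ (hL1 n) hk
      have h3 : 2 ^ n * (|c n| * C k n) ≤ L n := by
        have : 2 ^ n * (|c n| * C k n) ≤ 2 ^ n * (|c n| * ∑ k ∈ Finset.range n, C k n) := by
          gcongr
        simp only [L]; linarith
      rw [abs_div, abs_of_pos (pow_pos hLp n), one_div, inv_pow, ← one_div, div_mul_eq_mul_div,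
        div_le_div_iff₀ (by positivity) (by positivity)]
      have := mul_le_mul_of_nonneg_right h3 (pow_pos hLp k).le
      nlinarith
    · exact hgen
  refine ⟨fun x => ∑' n, u n x, contDiff_tsum (fun n => hu n) (fun k _ => hv k)
    (fun k n x _ => huv k n x), fun k => ?_⟩
  have hder : iteratedDeriv k (fun x => ∑' n, u n x) 0 = ∑' n, iteratedDeriv k (u n) 0 := by
    simp only [iteratedDeriv_eq_iteratedFDeriv]
    rw [iteratedFDeriv_tsum_apply (N := (⊤ : ℕ∞)) (fun n => hu n) (fun k _ => hv k)
      (fun k n x _ => huv k n x) le_top]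
    have hs : Summable fun n => iteratedFDeriv ℝ k (u n) 0 :=
      Summable.of_norm_bounded (hv k) fun n => huv k n 0
    exact (ContinuousMultilinearMap.apply ℝ (fun _ : Fin k => ℝ) ℝ (fun _ => 1)).map_tsum hs
  have hval : ∀ n, iteratedDeriv k (u n) 0 = if n = k then a k else 0 := by
    intro n
    have hLp : 0 < L n := lt_of_lt_of_le one_pos (hL1 n)
    have hev : ψ n =ᶠ[nhds 0] fun x => x ^ n := by
      filter_upwards [χ.eventuallyEq_one] with x hx
      simp [ψ, hx]
    rw [hud, mul_zero, hev.iteratedDeriv_eq]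
    rw [iteratedDeriv_pow]
    split_ifs with h
    · subst h
      have : (n.factorial : ℝ) ≠ 0 := by positivity
      simp [Nat.descFactorial_self, c]
      field_simp
    · rcases lt_or_gt_of_ne h with h | h
      · simp [Nat.descFactorial_of_lt h]
      · simp [Nat.sub_ne_zero_of_lt h]
  rw [hder]
  simp only [hval]
  exact tsum_ite_eq k _

/-- Whitney's theorem on even functions. -/
lemma aux_whitney {f : ℝ → ℝ} (hf : ContDiff ℝ (⊤ : ℕ∞) f) (he : ∀ x, f (-x) = f x) :
    ∃ G : ℝ → ℝ, ContDiff ℝ (⊤ : ℕ∞) G ∧ ∀ x, G (x ^ 2) = f x := by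
  let T := {f : ℝ → ℝ // ContDiff ℝ (⊤ : ℕ∞) f ∧ ∀ x, f (-x) = f x}
  have hstep : ∀ p : T, ∃ q : T, ∀ x, deriv p.1 x = 2 * x * q.1 x := by
    rintro ⟨p, hp, hpe⟩
    obtain ⟨q, h1, h2, h3⟩ := aux_div hp hpe
    exact ⟨⟨q, h1, h2⟩, h3⟩
  choose D hD using hstep
  let φ : ℕ → T := fun n => D^[n] ⟨f, hf, he⟩
  have hφ : ∀ n x, deriv (φ n).1 x = 2 * x * (φ (n+1)).1 x := by
    intro n x
    simp only [φ, Function.iterate_succ_apply']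
    exact hD _ x
  obtain ⟨b, hb, hb0⟩ := aux_borel (fun n => (φ n).1 0)
  let S : ℕ → ℝ → ℝ := fun n y => if 0 ≤ y then (φ n).1 (√y) else iteratedDeriv n b y
  have hS : ∀ n x, HasDerivAt (S n) (S (n+1) x) x := by
    intro n x
    have hr := aux_sqrt_hasDeriv (φ n).2.1 (φ (n+1)).2.1.continuous (hφ n) x
    have hl := aux_hasDerivAt_iteratedDeriv hb n x
    rcases lt_trichotomy x 0 with hx | rfl | hx
    · have : S (n+1) x = iteratedDeriv (n+1) b x := by simp [S, hx.not_ge]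
      rw [this]
      refine hl.congr_of_eventuallyEq ?_
      filter_upwards [Iio_mem_nhds hx] with z hz
      have hz : z < 0 := hz
      simp [S, hz.not_ge]
    · have h1 : HasDerivWithinAt (S n) (S (n+1) 0) (Set.Ici 0) 0 := by
        have e : S (n+1) 0 = (φ (n+1)).1 (√0) := by simp [S]
        rw [e]
        refine (hr le_rfl).1.congr (fun z hz => ?_) (by simp [S])
        have hz : 0 ≤ z := hz
        simp [S, hz]
      have h2 : HasDerivWithinAt (S n) (S (n+1) 0) (Set.Iic 0) 0 := by
        have e : S (n+1) 0 = iteratedDeriv (n+1) b 0 := by simp [S, hb0]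
        rw [e]
        refine hl.hasDerivWithinAt.congr (fun z hz => ?_) (by simp [S, hb0])
        have hz : z ≤ 0 := hz
        rcases hz.lt_or_eq with hz | rfl
        · simp [S, hz.not_ge]
        · simp [S, hb0]
      have := h2.union h1
      rwa [Set.Iic_union_Ici, hasDerivWithinAt_univ] at this
    · have : S (n+1) x = (φ (n+1)).1 (√x) := by simp [S, hx.le]
      rw [this]
      refine ((hr hx.le).2 hx).congr_of_eventuallyEq ?_
      filter_upwards [Ioi_mem_nhds hx] with z hz
      have hz : 0 < z := hz
      simp [S, hz.le]
  refine ⟨S 0, aux_contDiff_of_seq S hS, fun x => ?_⟩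
  have : S 0 (x ^ 2) = f |x| := by simp [S, φ, sq_nonneg, Real.sqrt_sq_eq_abs]
  rw [this]
  rcases abs_choice x with h | h <;> rw [h]
  exact he x

/-- Case (i) of the vertex criterion (`k_i = 0`, index in `Q`): if
`x ↦ √(g(x²))` is smooth on `ℝ`, then there is a smooth `G : ℝ → ℝ` with
`G(x²) = √(2g(x²/2))`, and the surface of revolution
`(x,t) ↦ (x cos k₁t, x sin k₁t, √(2g(x²/2)), 0) ∈ ℝ⁴` (with `k₁ ≠ 0`) is the
image of the smooth map `ζ ↦ (Re ζ, Im ζ, G(|ζ|²), 0)` under `ζ = x e^{ik₁t}`,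
hence smooth at `x = 0`. -/
theorem stmt15 (g : ℝ → ℝ)
    (hg : ContDiff ℝ (⊤ : ℕ∞) (fun x : ℝ => Real.sqrt (g (x ^ 2))))
    (k₁ : ℝ) (hk₁ : k₁ ≠ 0) :
    ∃ G : ℝ → ℝ, ContDiff ℝ (⊤ : ℕ∞) G ∧
      (∀ x : ℝ, G (x ^ 2) = Real.sqrt (2 * g (x ^ 2 / 2))) ∧
      ContDiff ℝ (⊤ : ℕ∞)
        (fun ζ : ℂ => (ζ.re, ζ.im, G (Complex.normSq ζ), (0 : ℝ))) ∧
      ∀ x t : ℝ,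
        (fun ζ : ℂ => (ζ.re, ζ.im, G (Complex.normSq ζ), (0 : ℝ)))
            ((x : ℂ) * Complex.exp (Complex.I * ((k₁ * t : ℝ) : ℂ)))
          = (x * Real.cos (k₁ * t), x * Real.sin (k₁ * t),
              Real.sqrt (2 * g (x ^ 2 / 2)), (0 : ℝ)) := by
  have hs2 : (0:ℝ) ≤ 2 := by norm_num
  have key : ∀ x : ℝ, √(2 * g (x ^ 2 / 2)) = √2 * √(g ((x / √2) ^ 2)) := by
    intro x
    rw [div_pow, Real.sq_sqrt hs2, Real.sqrt_mul hs2]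
  have hF : ContDiff ℝ (⊤ : ℕ∞) (fun x : ℝ => √(2 * g (x ^ 2 / 2))) := by
    simp only [key]
    exact contDiff_const.mul (hg.comp (contDiff_id.div_const (√2)))
  obtain ⟨G, hG, hGx⟩ := aux_whitney hF (fun x => by simp)
  refine ⟨G, hG, hGx, ?_, ?_⟩
  · have hre : ContDiff ℝ (⊤ : ℕ∞) (fun ζ : ℂ => ζ.re) := Complex.reCLM.contDiff
    have him : ContDiff ℝ (⊤ : ℕ∞) (fun ζ : ℂ => ζ.im) := Complex.imCLM.contDiff
    have hn : ContDiff ℝ (⊤ : ℕ∞) (fun ζ : ℂ => Complex.normSq ζ) := by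
      simp only [Complex.normSq_apply]
      exact (hre.mul hre).add (him.mul him)
    exact hre.prodMk (him.prodMk ((hG.comp hn).prodMk contDiff_const))
  · intro x t
    have e : Complex.exp (Complex.I * ((k₁ * t : ℝ) : ℂ))
        = (Real.cos (k₁ * t) : ℂ) + (Real.sin (k₁ * t) : ℂ) * Complex.I := by
      rw [mul_comm, Complex.exp_mul_I, Complex.ofReal_cos, Complex.ofReal_sin]
    have h1 : ((x : ℂ) * Complex.exp (Complex.I * ((k₁ * t : ℝ) : ℂ))).re
        = x * Real.cos (k₁ * t) := by
      rw [e, Complex.re_ofReal_mul, Complex.add_re, Complex.ofReal_re, Complex.re_ofReal_mul]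
      simp
    have h2 : ((x : ℂ) * Complex.exp (Complex.I * ((k₁ * t : ℝ) : ℂ))).im
        = x * Real.sin (k₁ * t) := by
      rw [e, Complex.im_ofReal_mul, Complex.add_im, Complex.ofReal_im, Complex.im_ofReal_mul]
      simp
    have h3 : Complex.normSq ((x : ℂ) * Complex.exp (Complex.I * ((k₁ * t : ℝ) : ℂ))) = x ^ 2 := by
      rw [Complex.normSq_apply, h1, h2]
      nlinarith [Real.sin_sq_add_cos_sq (k₁ * t)]
    simp only [h1, h2, h3, hGx]
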